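/- (Main theorem) For every k ≥ 0, all compositions of n ≥ 3k+1 can be reconstructed from their sets of k-deletions: if w and w' are compositions of the same integer n ≥ 3k+1 with the same set of k-deletions, then w = w'. -/

import Mathlib

/-- A composition: a word of positive integers. -/
def IsComposition (w : List ℕ) : Prop := ∀ x ∈ w, 1 ≤ x

/-- Containment order on compositions: `u` embeds entrywise into a subword of `w`. -/
def CompLE (u w : List ℕ) : Prop :=
  ∃ v : List ℕ, v.Sublist w ∧ List.Forall₂ (· ≤ ·) u v

/-- The set of `k`-deletions of `w`: compositions `u ≤ w` with `‖u‖ = ‖w‖ - k`. -/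
def kDel (k : ℕ) (w : List ℕ) : Set (List ℕ) :=
  {u | IsComposition u ∧ CompLE u w ∧ u.sum + k = w.sum}

namespace CompLE

theorem iff_sublistForall₂ {u w : List ℕ} : CompLE u w ↔ List.SublistForall₂ (· ≤ ·) u w := by
  simp only [CompLE, List.sublistForall₂_iff, and_comm]

theorem nil_left (w : List ℕ) : CompLE [] w :=
  iff_sublistForall₂.2 .nil

theorem refl (w : List ℕ) : CompLE w w :=
  ⟨w, List.Sublist.refl w, List.forall₂_refl w⟩

theorem trans {u v w : List ℕ} (h₁ : CompLE u v) (h₂ : CompLE v w) : CompLE u w := by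
  rw [iff_sublistForall₂] at *
  exact _root_.trans h₁ h₂

theorem cons {c x : ℕ} {u y : List ℕ} (hc : c ≤ x) (h : CompLE u y) :
    CompLE (c :: u) (x :: y) :=
  iff_sublistForall₂.2 (.cons hc (iff_sublistForall₂.1 h))

theorem cons_right {u y : List ℕ} (x : ℕ) (h : CompLE u y) : CompLE u (x :: y) :=
  iff_sublistForall₂.2 (.cons_right (iff_sublistForall₂.1 h))

theorem not_cons_nil {c : ℕ} {u : List ℕ} : ¬ CompLE (c :: u) [] := by
  rw [iff_sublistForall₂]
  rintro ⟨⟩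

theorem of_cons_cons {c x : ℕ} {u y : List ℕ} (h : CompLE (c :: u) (x :: y)) :
    (c ≤ x ∧ CompLE u y) ∨ CompLE (c :: u) y := by
  simp only [iff_sublistForall₂] at *
  cases h with
  | cons h₁ h₂ => exact .inl ⟨h₁, h₂⟩
  | cons_right h => exact .inr h

theorem tail_left {c : ℕ} {u y : List ℕ} (h : CompLE (c :: u) y) : CompLE u y :=
  (cons_right c (refl u)).trans h

theorem cons_cons_tail {c x : ℕ} {u y : List ℕ} (h : CompLE (c :: u) (x :: y)) : CompLE u y :=
  (of_cons_cons h).elim And.right tail_left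

theorem length_le {u w : List ℕ} (h : CompLE u w) : u.length ≤ w.length := by
  obtain ⟨v, hv, hu⟩ := h
  exact hu.length_eq ▸ hv.length_le

theorem forall₂ {u w : List ℕ} (h : CompLE u w) (hl : u.length = w.length) :
    List.Forall₂ (· ≤ ·) u w := by
  obtain ⟨v, hv, hu⟩ := h
  exact hv.eq_of_length (hu.length_eq ▸ hl) ▸ hu

theorem append {u w u' w' : List ℕ} (h : CompLE u w) (h' : CompLE u' w') :
    CompLE (u ++ u') (w ++ w') := by
  obtain ⟨v, hv, hu⟩ := h
  obtain ⟨v', hv', hu'⟩ := h'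
  exact ⟨v ++ v', hv.append hv', List.rel_append hu hu'⟩

theorem append_left {u y : List ℕ} (x : List ℕ) (h : CompLE u y) : CompLE u (x ++ y) :=
  append (nil_left x) h

theorem reverse {u w : List ℕ} (h : CompLE u w) : CompLE u.reverse w.reverse := by
  obtain ⟨v, hv, hu⟩ := h
  exact ⟨v.reverse, hv.reverse, List.rel_reverse hu⟩

theorem reverse_iff {u w : List ℕ} : CompLE u.reverse w.reverse ↔ CompLE u w :=
  ⟨fun h => by simpa using h.reverse, reverse⟩

/-- The containment order is graded: every intermediate size is attained. -/
theorem exists_sum_eq {u w : List ℕ} (h : CompLE u w) (hu : IsComposition u)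
    (hw : IsComposition w) {s : ℕ} (h₁ : u.sum ≤ s) (h₂ : s ≤ w.sum) :
    ∃ v, IsComposition v ∧ v.sum = s ∧ CompLE u v ∧ CompLE v w := by
  induction w generalizing u s with
  | nil =>
    obtain rfl : s = 0 := by simpa using h₂
    cases u with
    | nil => exact ⟨[], hu, rfl, refl _, refl _⟩
    | cons c u => exact absurd h not_cons_nil
  | cons x w ih =>
    have hw' : IsComposition w := fun y hy => hw y (by simp [hy])
    have drop (hle : CompLE u w) :
        ∃ v, IsComposition v ∧ v.sum = s ∧ CompLE u v ∧ CompLE v (x :: w) := by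
      by_cases hs : s ≤ w.sum
      · obtain ⟨v, hv, hvs, huv, hvw⟩ := ih hle hu hw' h₁ hs
        exact ⟨v, hv, hvs, huv, hvw.cons_right x⟩
      · simp only [List.sum_cons] at h₂
        refine ⟨(s - w.sum) :: w, ?_, by simp; omega, hle.cons_right _, cons (by omega) (refl w)⟩
        intro y hy
        rcases List.mem_cons.1 hy with rfl | hy
        · omega
        · exact hw' y hy
    cases u with
    | nil => exact drop (nil_left w)
    | cons c u =>
      rcases of_cons_cons h with ⟨hcx, hle⟩ | hle
      · have hu' : IsComposition u := fun y hy => hu y (by simp [hy])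
        have hc : 1 ≤ c := hu c (by simp)
        have hsum := List.SublistForall₂.sum_le_sum (iff_sublistForall₂.1 hle) (by simp)
        simp only [List.sum_cons] at h₁ h₂
        obtain ⟨v, hv, hvs, huv, hvw⟩ :=
          ih (s := min (s - c) w.sum) hle hu' hw' (by omega) (by omega)
        refine ⟨(s - v.sum) :: v, ?_, by simp; omega, cons (by omega) huv, cons (by omega) hvw⟩
        intro y hy
        rcases List.mem_cons.1 hy with rfl | hy
        · omega
        · exact hv y hy
      · exact drop hle

theorem of_ones_append {c a : ℕ} {u y : List ℕ} (hc : 2 ≤ c)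
    (h : CompLE (c :: u) (List.replicate a 1 ++ y)) : CompLE (c :: u) y := by
  induction a with
  | zero => simpa using h
  | succ a ih =>
    rw [List.replicate_succ, List.cons_append] at h
    rcases of_cons_cons h with ⟨h, _⟩ | h
    · omega
    · exact ih h

end CompLE

/-- `t` is a letter that must reach past `a` ones, up to the next larger part. -/
def IsToken (t a : ℕ) : Prop := t = 2 ∨ (t = 1 ∧ a = 0)

theorem IsToken.one_le {t a : ℕ} (h : IsToken t a) : 1 ≤ t := by
  rcases h with h | h <;> omega

theorem IsToken.compLE_block_iff {t a b : ℕ} {u y : List ℕ} (ht : IsToken t a) (hb : 2 ≤ b) :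
    CompLE (t :: u) ((List.replicate a 1 ++ [b]) ++ y) ↔ CompLE u y := by
  constructor
  · intro h
    rcases ht with rfl | ⟨rfl, rfl⟩
    · rw [List.append_assoc] at h
      exact (h.of_ones_append le_rfl).cons_cons_tail
    · exact CompLE.cons_cons_tail (by simpa using h)
  · intro h
    rw [List.append_assoc]
    refine CompLE.append_left _ (CompLE.cons ?_ h)
    rcases ht with h | h <;> omega

theorem IsToken.compLE_block_right_iff {t a b : ℕ} {u y : List ℕ} (ht : IsToken t a)
    (hb : 2 ≤ b) : CompLE (u ++ [t]) (y ++ (b :: List.replicate a 1)) ↔ CompLE u y := by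
  rw [← CompLE.reverse_iff, ← CompLE.reverse_iff (u := u)]
  simpa using ht.compLE_block_iff (u := u.reverse) (y := y.reverse) hb

/-- The word `1 ^ a 0, b 0, 1 ^ a 1, b 1, …, 1 ^ a (i - 1), b (i - 1)`. -/
def blockPrefix (a b : ℕ → ℕ) : ℕ → List ℕ
  | 0 => []
  | i + 1 => blockPrefix a b i ++ (List.replicate (a i) 1 ++ [b i])

/-- The word `b i, 1 ^ a (i + 1), …, b (i + k - 1), 1 ^ a (i + k)`. -/
def blockSuffix (a b : ℕ → ℕ) : ℕ → ℕ → List ℕ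
  | _, 0 => []
  | i, k + 1 => (b i :: List.replicate (a (i + 1)) 1) ++ blockSuffix a b (i + 1) k

/-- The word `1 ^ a 0, b 0, 1 ^ a 1, b 1, …, b (r - 1), 1 ^ a r`. -/
def blockWord (a b : ℕ → ℕ) (r : ℕ) : List ℕ := blockPrefix a b r ++ List.replicate (a r) 1

theorem blockWord_add (a b : ℕ → ℕ) (i k : ℕ) :
    blockWord a b (i + k) =
      blockPrefix a b i ++ (List.replicate (a i) 1 ++ blockSuffix a b i k) := by
  induction k generalizing i with
  | zero => simp [blockWord, blockSuffix]
  | succ k ih =>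
    rw [show i + (k + 1) = i + 1 + k by omega, ih]
    simp [blockPrefix, blockSuffix]

theorem blockPrefix_congr {a b a' b' : ℕ → ℕ} {i : ℕ} (ha : ∀ s < i, a s = a' s)
    (hb : ∀ s < i, b s = b' s) : blockPrefix a b i = blockPrefix a' b' i := by
  induction i with
  | zero => rfl
  | succ i ih =>
    rw [blockPrefix, blockPrefix, ih (fun s hs => ha s (by omega)) fun s hs => hb s (by omega),
      ha i (by omega), hb i (by omega)]

theorem sum_blockPrefix (a b : ℕ → ℕ) (i : ℕ) :
    (blockPrefix a b i).sum = ∑ s ∈ Finset.range i, a s + ∑ s ∈ Finset.range i, b s := by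
  induction i with
  | zero => rfl
  | succ i ih =>
    simp [blockPrefix, ih, Finset.sum_range_succ]
    omega

theorem sum_blockWord (a b : ℕ → ℕ) (r : ℕ) :
    (blockWord a b r).sum = ∑ s ∈ Finset.range (r + 1), a s + ∑ s ∈ Finset.range r, b s := by
  simp [blockWord, sum_blockPrefix, Finset.sum_range_succ]
  omega

theorem length_blockPrefix (a b : ℕ → ℕ) (i : ℕ) :
    (blockPrefix a b i).length = ∑ s ∈ Finset.range i, a s + i := by
  induction i with
  | zero => rfl
  | succ i ih =>
    simp [blockPrefix, ih, Finset.sum_range_succ]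
    omega

theorem length_blockWord (a b : ℕ → ℕ) (r : ℕ) :
    (blockWord a b r).length = ∑ s ∈ Finset.range (r + 1), a s + r := by
  simp [blockWord, length_blockPrefix, Finset.sum_range_succ]
  omega

theorem tokens_compLE_blockPrefix_iff {τ a b : ℕ → ℕ} {i : ℕ} {u y : List ℕ}
    (hτ : ∀ s < i, IsToken (τ s) (a s)) (hb : ∀ s < i, 2 ≤ b s) :
    CompLE ((List.range i).map τ ++ u) (blockPrefix a b i ++ y) ↔ CompLE u y := by
  induction i generalizing u y with
  | zero => simp [blockPrefix]
  | succ i ih =>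
    rw [List.range_succ, List.map_append, blockPrefix, List.append_assoc, List.append_assoc,
      ih (fun s hs => hτ s (by omega)) fun s hs => hb s (by omega)]
    exact (hτ i (by omega)).compLE_block_iff (hb i (by omega))

theorem tokens_compLE_blockSuffix_iff {τ a b : ℕ → ℕ} {i k : ℕ} {u y : List ℕ}
    (hτ : ∀ s ≤ i + k, IsToken (τ s) (a s)) (hb : ∀ s < i + k, 2 ≤ b s) :
    CompLE (u ++ (List.range' (i + 1) k).map τ) (y ++ blockSuffix a b i k) ↔ CompLE u y := by
  induction k generalizing i u y with
  | zero => simp [blockSuffix]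
  | succ k ih =>
    rw [List.range'_succ, List.map_cons, blockSuffix, ← List.append_assoc,
      List.append_cons u,
      ih (fun s hs => hτ s (by omega)) fun s hs => hb s (by omega)]
    exact (hτ (i + 1) (by omega)).compLE_block_right_iff (hb i (by omega))

theorem sum_tokens (τ : ℕ → ℕ) (i k : ℕ) :
    ((List.range i).map τ).sum + τ i + ((List.range' (i + 1) k).map τ).sum =
      ∑ s ∈ Finset.range (i + k + 1), τ s := by
  have h : ∀ i, ((List.range i).map τ).sum = ∑ s ∈ Finset.range i, τ s := fun i => by
    induction i with
    | zero => rfl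
    | succ i ih => simp [List.range_succ, Finset.sum_range_succ, ih]
  induction k generalizing i with
  | zero => simp [h, Finset.sum_range_succ]
  | succ k ih =>
    have := ih (i + 1)
    rw [show i + (k + 1) + 1 = i + 1 + k + 1 by omega, ← this, List.range'_succ, h, h,
      Finset.sum_range_succ]
    simp
    omega

theorem compLE_of_kDel_subset {k : ℕ} {w w' u : List ℕ} (hw' : IsComposition w')
    (hdel : kDel k w' ⊆ kDel k w) (hu : IsComposition u) (hs : u.sum + k ≤ w'.sum)
    (h : CompLE u w') : CompLE u w := by
  obtain ⟨v, hv, hvs, huv, hvw⟩ :=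
    h.exists_sum_eq hu hw' (s := w'.sum - k) (by omega) (by omega)
  exact huv.trans (hdel ⟨hv, hvw, by omega⟩).2.1

theorem isComposition_tokens {τ a : ℕ → ℕ} {l : List ℕ} (hτ : ∀ s ∈ l, IsToken (τ s) (a s)) :
    IsComposition (l.map τ) := by
  intro x hx
  obtain ⟨s, hs, rfl⟩ := List.mem_map.1 hx
  exact (hτ s hs).one_le

theorem IsComposition.append {u v : List ℕ} (hu : IsComposition u) (hv : IsComposition v) :
    IsComposition (u ++ v) := fun x hx => (List.mem_append.1 hx).elim (hu x) (hv x)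

section Bounds

variable {a b a' b' τ : ℕ → ℕ} {r m i : ℕ}

theorem le_of_gap_lt
    (H : ∀ u, IsComposition u → u.sum ≤ m →
      CompLE u (blockWord a' b' r) → CompLE u (blockWord a b r))
    (hτ : ∀ s ≤ r, IsToken (τ s) (a s)) (hτ' : ∀ s ≤ r, IsToken (τ s) (a' s))
    (hb : ∀ s < r, 2 ≤ b s) (hb' : ∀ s < r, 2 ≤ b' s) (hi : i ≤ r) (ha : a i < a' i) :
    m + τ i ≤ ∑ s ∈ Finset.range (r + 1), τ s + a i := by
  by_contra! hlt
  obtain ⟨k, rfl⟩ := Nat.exists_eq_add_of_le hi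
  have hsum := sum_tokens τ i k
  have iff (a b : ℕ → ℕ) (hτ : ∀ s ≤ i + k, IsToken (τ s) (a s)) (hb : ∀ s < i + k, 2 ≤ b s)
      (t : List ℕ) :
      CompLE ((List.range i).map τ ++ (t ++ (List.range' (i + 1) k).map τ))
        (blockWord a b (i + k)) ↔ CompLE t (List.replicate (a i) 1) := by
    rw [blockWord_add, tokens_compLE_blockPrefix_iff (fun s hs => hτ s (by omega))
      fun s hs => hb s (by omega), tokens_compLE_blockSuffix_iff hτ hb]
  have h := H ((List.range i).map τ ++
      (List.replicate (a i + 1) 1 ++ (List.range' (i + 1) k).map τ)) ?_ ?_ ?_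
  · rw [iff a b hτ hb] at h
    simpa using h.length_le
  · refine (isComposition_tokens fun s hs => hτ s ?_).append
      (IsComposition.append ?_ (isComposition_tokens fun s hs => hτ s ?_))
    · have := List.mem_range.1 hs; omega
    · intro x hx; rw [List.eq_of_mem_replicate hx]
    · have := List.mem_range'_1.1 hs; omega
  · simp only [List.sum_append, List.sum_replicate, smul_eq_mul, mul_one]
    omega
  · rw [iff a' b' hτ' hb']
    exact ⟨_, (List.replicate_sublist_replicate 1).2 ha, List.forall₂_refl _⟩

theorem le_of_part_lt
    (H : ∀ u, IsComposition u → u.sum ≤ m →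
      CompLE u (blockWord a' b' r) → CompLE u (blockWord a b r))
    (hτ : ∀ s ≤ r, IsToken (τ s) (a s)) (hτ' : ∀ s ≤ r, IsToken (τ s) (a' s))
    (hb : ∀ s < r, 2 ≤ b s) (hb' : ∀ s < r, 2 ≤ b' s) (hi : i < r) (hbi : b i < b' i) :
    m + τ i + τ (i + 1) ≤ ∑ s ∈ Finset.range (r + 1), τ s + b i := by
  by_contra! hlt
  obtain ⟨k, rfl⟩ : ∃ k, r = i + 1 + k := Nat.exists_eq_add_of_le hi
  have hsum := sum_tokens τ i (k + 1)
  rw [show i + (k + 1) + 1 = i + 1 + k + 1 by omega, List.range'_succ] at hsum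
  simp only [List.map_cons, List.sum_cons] at hsum
  have h2 : 2 ≤ b i + 1 := by have := hb i hi; omega
  have iff (a b : ℕ → ℕ) (hτ : ∀ s ≤ i + 1 + k, IsToken (τ s) (a s))
      (hb : ∀ s < i + 1 + k, 2 ≤ b s) (t : List ℕ) :
      CompLE ((List.range i).map τ ++ (t ++ (List.range' (i + 1 + 1) k).map τ))
        (blockWord a b (i + 1 + k)) ↔
      CompLE t (List.replicate (a i) 1 ++ b i :: List.replicate (a (i + 1)) 1) := by
    rw [show i + 1 + k = i + (k + 1) by omega, blockWord_add,
      tokens_compLE_blockPrefix_iff (fun s hs => hτ s (by omega)) fun s hs => hb s (by omega),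
      blockSuffix, ← List.append_assoc, tokens_compLE_blockSuffix_iff hτ hb]
  have h := H ((List.range i).map τ ++
      ([b i + 1] ++ (List.range' (i + 1 + 1) k).map τ)) ?_ ?_ ?_
  · rw [iff a b hτ hb] at h
    rcases (h.of_ones_append h2).of_cons_cons with ⟨h, _⟩ | h
    · omega
    · rw [← List.append_nil (List.replicate _ 1)] at h
      exact CompLE.not_cons_nil (h.of_ones_append h2)
  · refine (isComposition_tokens fun s hs => hτ s ?_).append
      (IsComposition.append ?_ (isComposition_tokens fun s hs => hτ s ?_))
    · have := List.mem_range.1 hs; omega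
    · intro x hx; rw [List.mem_singleton.1 hx]; omega
    · have := List.mem_range'_1.1 hs; omega
  · simp only [List.sum_append, List.sum_singleton]
    omega
  · rw [iff a' b' hτ' hb']
    exact CompLE.append_left _ (CompLE.cons hbi (CompLE.nil_left _))

end Bounds

/-- Two words of equal length with the same positions of ones share their gaps. -/
theorem exists_blockWord_of_zip (P : List (ℕ × ℕ))
    (hP : ∀ p ∈ P, (p.1 = 1 ∧ p.2 = 1) ∨ (2 ≤ p.1 ∧ 2 ≤ p.2)) :
    ∃ (r : ℕ) (a b b' : ℕ → ℕ), (∀ s < r, 2 ≤ b s) ∧ (∀ s < r, 2 ≤ b' s) ∧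
      P.map Prod.fst = blockWord a b r ∧ P.map Prod.snd = blockWord a b' r := by
  induction P using List.reverseRecOn with
  | nil => exact ⟨0, 0, 0, 0, by simp, by simp, rfl, rfl⟩
  | append_singleton P p ih =>
    obtain ⟨r, a, b, b', hb, hb', h, h'⟩ := ih fun q hq => hP q (by simp [hq])
    rcases hP p (by simp) with ⟨h1, h2⟩ | ⟨h1, h2⟩
    · have key (b : ℕ → ℕ) : blockWord a b r ++ [1] =
          blockWord (Function.update a r (a r + 1)) b r := by
        rw [blockWord, blockWord, Function.update_self, List.replicate_succ', List.append_assoc,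
          blockPrefix_congr (fun s hs => ?_) fun s _ => rfl]
        rw [Function.update_of_ne hs.ne]
      refine ⟨r, Function.update a r (a r + 1), b, b', hb, hb', ?_, ?_⟩
      · rw [List.map_append, h, ← key, List.map_singleton, h1]
      · rw [List.map_append, h', ← key, List.map_singleton, h2]
    · have key (b : ℕ → ℕ) (x : ℕ) : blockWord a b r ++ [x] =
          blockWord (Function.update a (r + 1) 0) (Function.update b r x) (r + 1) := by
        rw [blockWord, blockWord, blockPrefix, Function.update_self, Function.update_self,
          Function.update_of_ne (Nat.lt_succ_self r).ne, List.append_assoc,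
          List.replicate_zero, List.append_nil,
          blockPrefix_congr (fun s hs => ?_) fun s hs => ?_]
        · rw [Function.update_of_ne (by omega)]
        · rw [Function.update_of_ne (by omega)]
      have two_le (b : ℕ → ℕ) (x : ℕ) (hb : ∀ s < r, 2 ≤ b s) (hx : 2 ≤ x) :
          ∀ s < r + 1, 2 ≤ Function.update b r x s := by
        intro s hs
        rcases eq_or_ne s r with rfl | hne
        · simpa
        · rw [Function.update_of_ne hne]
          exact hb s (by omega)
      refine ⟨r + 1, Function.update a (r + 1) 0, Function.update b r p.1,
        Function.update b' r p.2, two_le b _ hb h1, two_le b' _ hb' h2, ?_, ?_⟩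
      · rw [List.map_append, h, ← key, List.map_singleton]
      · rw [List.map_append, h', ← key, List.map_singleton]

theorem IsComposition.exists_blockWord {w : List ℕ} (hw : IsComposition w) :
    ∃ (r : ℕ) (a b : ℕ → ℕ), (∀ s < r, 2 ≤ b s) ∧ w = blockWord a b r := by
  obtain ⟨r, a, b, -, hb, -, h, -⟩ := exists_blockWord_of_zip (w.map fun x => (x, x)) (by
    intro p hp
    obtain ⟨x, hx, rfl⟩ := List.mem_map.1 hp
    have := hw x hx
    simp only
    omega)
  exact ⟨r, a, b, hb, by simpa [Function.comp_def] using h⟩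

section Slack

variable {a b τ : ℕ → ℕ} {r m i j : ℕ}

theorem three_mul_sum_tokens_add (h : ∀ s ≤ r, 3 * τ s ≤ 2 * a s + 4) :
    3 * ∑ s ∈ Finset.range (r + 1), τ s + ∑ s ∈ Finset.range (r + 1), (2 * a s + 4 - 3 * τ s) =
      2 * ∑ s ∈ Finset.range (r + 1), a s + 4 * (r + 1) := by
  rw [Finset.mul_sum, Finset.mul_sum, ← Finset.sum_add_distrib,
    Finset.sum_congr rfl fun s hs =>
      Nat.add_sub_cancel' (h s (by simpa [Nat.lt_succ_iff] using hs)),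
    Finset.sum_add_distrib]
  simp [mul_comm]

theorem two_mul_add_sum_sub (hb : ∀ s < r, 2 ≤ b s) :
    2 * r + ∑ s ∈ Finset.range r, (b s - 2) = ∑ s ∈ Finset.range r, b s := by
  rw [← Finset.sum_congr rfl fun s hs => Nat.add_sub_cancel' (hb s (Finset.mem_range.1 hs)),
    Finset.sum_add_distrib]
  simp [mul_comm]

theorem le_sum_range {f : ℕ → ℕ} (hi : i < r) : f i ≤ ∑ s ∈ Finset.range r, f s :=
  Finset.single_le_sum (fun _ _ => Nat.zero_le _) (Finset.mem_range.2 hi)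

theorem add_le_sum_range {f : ℕ → ℕ} (hi : i < r) (hj : j < r) (hij : i ≠ j) :
    f i + f j ≤ ∑ s ∈ Finset.range r, f s := by
  rw [← Finset.sum_pair hij]
  refine Finset.sum_le_sum_of_subset fun s hs => ?_
  rcases Finset.mem_insert.1 hs with rfl | hs
  · exact Finset.mem_range.2 hi
  · exact Finset.mem_singleton.1 hs ▸ Finset.mem_range.2 hj

theorem two_mul_gap_le_of_gap
    (hτ : ∀ s ≤ r, (a s = 0 ∧ τ s = 1) ∨ (1 ≤ a s ∧ τ s = 2)) (hb : ∀ s < r, 2 ≤ b s)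
    (hm : 2 * (∑ s ∈ Finset.range (r + 1), a s + ∑ s ∈ Finset.range r, b s) + 1 ≤ 3 * m)
    (hi : i ≤ r) (hj : j ≤ r) (hij : i ≠ j) (hai : 1 ≤ a i)
    (h : m + τ i ≤ ∑ s ∈ Finset.range (r + 1), τ s + a i) : 2 * a j ≤ a i + 1 := by
  have h1 := three_mul_sum_tokens_add (τ := τ) (a := a) (r := r) fun s hs => by
    have := hτ s hs; omega
  have h2 := two_mul_add_sum_sub hb
  have h3 := add_le_sum_range (r := r + 1) (f := fun s => 2 * a s + 4 - 3 * τ s)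
    (Nat.lt_succ_of_le hi) (Nat.lt_succ_of_le hj) hij
  have := hτ i hi
  have := hτ j hj
  omega

theorem two_mul_part_le_of_gap
    (hτ : ∀ s ≤ r, (a s = 0 ∧ τ s = 1) ∨ (1 ≤ a s ∧ τ s = 2)) (hb : ∀ s < r, 2 ≤ b s)
    (hm : 2 * (∑ s ∈ Finset.range (r + 1), a s + ∑ s ∈ Finset.range r, b s) + 1 ≤ 3 * m)
    (hi : i ≤ r) (hj : j < r) (hai : 1 ≤ a i)
    (h : m + τ i ≤ ∑ s ∈ Finset.range (r + 1), τ s + a i) : 2 * b j ≤ a i + 3 := by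
  have h1 := three_mul_sum_tokens_add (τ := τ) (a := a) (r := r) fun s hs => by
    have := hτ s hs; omega
  have h2 := two_mul_add_sum_sub hb
  have h3 := le_sum_range (r := r + 1) (f := fun s => 2 * a s + 4 - 3 * τ s)
    (Nat.lt_succ_of_le hi)
  have h4 := le_sum_range (f := fun s => b s - 2) hj
  have := hτ i hi
  omega

theorem two_mul_gap_le_of_part
    (hτ : ∀ s ≤ r, (a s = 0 ∧ τ s = 1) ∨ (1 ≤ a s ∧ τ s = 2)) (hb : ∀ s < r, 2 ≤ b s)
    (hm : 2 * (∑ s ∈ Finset.range (r + 1), a s + ∑ s ∈ Finset.range r, b s) + 1 ≤ 3 * m)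
    (hi : i < r) (hj : j ≤ r)
    (h : m + τ i + τ (i + 1) ≤ ∑ s ∈ Finset.range (r + 1), τ s + b i) :
    2 * a j ≤ b i + 3 := by
  have h1 := three_mul_sum_tokens_add (τ := τ) (a := a) (r := r) fun s hs => by
    have := hτ s hs; omega
  have h2 := two_mul_add_sum_sub hb
  have h3 := le_sum_range (r := r + 1) (f := fun s => 2 * a s + 4 - 3 * τ s)
    (Nat.lt_succ_of_le hj)
  have h4 := le_sum_range (f := fun s => b s - 2) hi
  have := hτ i hi.le
  have := hτ (i + 1) hi
  have := hτ j hj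
  have := hb i hi
  omega

theorem two_mul_part_le_of_part
    (hτ : ∀ s ≤ r, (a s = 0 ∧ τ s = 1) ∨ (1 ≤ a s ∧ τ s = 2)) (hb : ∀ s < r, 2 ≤ b s)
    (hm : 2 * (∑ s ∈ Finset.range (r + 1), a s + ∑ s ∈ Finset.range r, b s) + 1 ≤ 3 * m)
    (hi : i < r) (hj : j < r) (hij : i ≠ j)
    (h : m + τ i + τ (i + 1) ≤ ∑ s ∈ Finset.range (r + 1), τ s + b i) :
    2 * b j ≤ b i + 3 := by
  have h1 := three_mul_sum_tokens_add (τ := τ) (a := a) (r := r) fun s hs => by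
    have := hτ s hs; omega
  have h2 := two_mul_add_sum_sub hb
  have h3 := add_le_sum_range (r := r + 1) (j := i + 1)
    (f := fun s => 2 * a s + 4 - 3 * τ s) (Nat.lt_succ_of_lt hi) (Nat.succ_lt_succ hi)
    (Nat.lt_succ_self i).ne
  have h4 := add_le_sum_range (f := fun s => b s - 2) hi hj hij
  have := hτ i hi.le
  have := hτ (i + 1) hi
  have := hb i hi
  have := hb j hj
  omega

end Slack

theorem exists_lt_of_blockWord_ne {a b a' b' : ℕ → ℕ} {r : ℕ}
    (hsum : (blockWord a b r).sum = (blockWord a' b' r).sum)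
    (hne : blockWord a b r ≠ blockWord a' b' r) :
    (∃ i ≤ r, a i < a' i) ∨ ∃ i < r, b i < b' i := by
  by_contra! hcon
  obtain ⟨ha, hb⟩ := hcon
  rw [sum_blockWord, sum_blockWord] at hsum
  have ha' : ∀ s ∈ Finset.range (r + 1), a' s ≤ a s := fun s hs =>
    ha s (Nat.lt_succ_iff.1 (Finset.mem_range.1 hs))
  have hb' : ∀ s ∈ Finset.range r, b' s ≤ b s := fun s hs => hb s (Finset.mem_range.1 hs)
  have hA := Finset.sum_le_sum ha'
  have hB := Finset.sum_le_sum hb'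
  have hA' := (Finset.sum_eq_sum_iff_of_le ha').1 (by omega)
  have hB' := (Finset.sum_eq_sum_iff_of_le hb').1 (by omega)
  refine hne ?_
  rw [blockWord, blockWord, hA' r (by simp),
    blockPrefix_congr (fun s hs => (hA' s ?_).symm) fun s hs => (hB' s ?_).symm]
  · simp; omega
  · simpa using hs

theorem blockWord_eq_of_compLE_iff {a b a' b' : ℕ → ℕ} {r m : ℕ}
    (H : ∀ u, IsComposition u → u.sum ≤ m →
      (CompLE u (blockWord a b r) ↔ CompLE u (blockWord a' b' r)))
    (hgap : ∀ s ≤ r, a s = a' s ∨ (1 ≤ a s ∧ 1 ≤ a' s))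
    (hb : ∀ s < r, 2 ≤ b s) (hb' : ∀ s < r, 2 ≤ b' s)
    (hsum : (blockWord a b r).sum = (blockWord a' b' r).sum)
    (hm : 2 * (blockWord a b r).sum + 1 ≤ 3 * m) :
    blockWord a b r = blockWord a' b' r := by
  by_contra hne
  have hlt := exists_lt_of_blockWord_ne hsum hne
  have hgt := exists_lt_of_blockWord_ne hsum.symm (Ne.symm hne)
  have hm' := hsum ▸ hm
  rw [sum_blockWord] at hm hm'
  let τ : ℕ → ℕ := fun s => if a s = 0 then 1 else 2
  have hτ : ∀ s ≤ r, (a s = 0 ∧ τ s = 1) ∨ (1 ≤ a s ∧ τ s = 2) := by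
    intro s _
    simp only [τ]
    split <;> omega
  have hτ' : ∀ s ≤ r, (a' s = 0 ∧ τ s = 1) ∨ (1 ≤ a' s ∧ τ s = 2) := by
    intro s hs
    have := hτ s hs
    have := hgap s hs
    omega
  have tok : ∀ s ≤ r, IsToken (τ s) (a s) := fun s hs => by
    have := hτ s hs
    unfold IsToken
    omega
  have tok' : ∀ s ≤ r, IsToken (τ s) (a' s) := fun s hs => by
    have := hτ' s hs
    unfold IsToken
    omega
  have gap {i} := le_of_gap_lt (i := i) (fun u hu hs => (H u hu hs).2) tok tok' hb hb'
  have gap' {i} := le_of_gap_lt (i := i) (fun u hu hs => (H u hu hs).1) tok' tok hb' hb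
  have part {i} := le_of_part_lt (i := i) (fun u hu hs => (H u hu hs).2) tok tok' hb hb'
  have part' {i} := le_of_part_lt (i := i) (fun u hu hs => (H u hu hs).1) tok' tok hb' hb
  rcases hlt with ⟨i, hi, hai⟩ | ⟨i, hi, hbi⟩ <;> rcases hgt with ⟨j, hj, haj⟩ | ⟨j, hj, hbj⟩
  · have := hgap i hi
    have := hgap j hj
    have hij : i ≠ j := by rintro rfl; omega
    have := two_mul_gap_le_of_gap hτ hb hm hi hj hij (by omega) (gap hi hai)
    have := two_mul_gap_le_of_gap hτ' hb' hm' hj hi hij.symm (by omega) (gap' hj haj)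
    omega
  · have := hgap i hi
    have := hb' j hj
    have := two_mul_part_le_of_gap hτ hb hm hi hj (by omega) (gap hi hai)
    have := two_mul_gap_le_of_part hτ' hb' hm' hj hi (part' hj hbj)
    omega
  · have := hgap j hj
    have := hb i hi
    have := two_mul_gap_le_of_part hτ hb hm hi hj (part hi hbi)
    have := two_mul_part_le_of_gap hτ' hb' hm' hj hi (by omega) (gap' hj haj)
    omega
  · have hij : i ≠ j := by rintro rfl; omega
    have := hb i hi
    have := hb' j hj
    have := two_mul_part_le_of_part hτ hb hm hi hj hij (part hi hbi)
    have := two_mul_part_le_of_part hτ' hb' hm' hj hi hij.symm (part' hj hbj)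
    omega

theorem IsComposition.ones_compLE {w : List ℕ} (hw : IsComposition w) {j : ℕ}
    (hj : j ≤ w.length) : CompLE (List.replicate j 1) w := by
  refine CompLE.trans ⟨_, (List.replicate_sublist_replicate 1).2 hj, List.forall₂_refl _⟩
    ⟨w, List.Sublist.refl w, ?_⟩
  exact List.forall₂_iff_get.2
    ⟨by simp, fun i _ h₂ => by simpa using hw _ (List.get_mem w ⟨i, h₂⟩)⟩

theorem isComposition_replicate {c : ℕ} (hc : 1 ≤ c) (j : ℕ) :
    IsComposition (List.replicate j c) := fun _ hx => (List.eq_of_mem_replicate hx).symm ▸ hc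

theorem length_le_of_compLE {w w' : List ℕ} {m : ℕ} (hw' : IsComposition w')
    (H : ∀ u, IsComposition u → u.sum ≤ m → CompLE u w' → CompLE u w) (hm : w.length < m) :
    w'.length ≤ w.length := by
  by_contra! hlt
  simpa using (H (List.replicate (w.length + 1) 1) (isComposition_replicate le_rfl _) (by simpa)
    (hw'.ones_compLE hlt)).length_le

theorem two_le_getElem_of_compLE {w w' : List ℕ} {m : ℕ} (hw' : IsComposition w')
    (H : ∀ u, IsComposition u → u.sum ≤ m → CompLE u w' → CompLE u w) (hm : w.length < m)
    (hl : w.length = w'.length) {i : ℕ} (hi : i < w.length) (hi' : i < w'.length)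
    (h : 2 ≤ w'[i]) : 2 ≤ w[i] := by
  have hlen : i + (w.length - 1 - i + 1) = w.length := by omega
  have hfor := (H (List.replicate i 1 ++ 2 :: List.replicate (w.length - 1 - i) 1)
    ?_ ?_ ?_).forall₂ (by simpa)
  · simpa using hfor.get (i := i) (by simp) hi
  · refine (isComposition_replicate le_rfl _).append fun x hx => ?_
    rcases List.mem_cons.1 hx with rfl | hx
    · omega
    · exact isComposition_replicate le_rfl _ x hx
  · simp
    omega
  · refine ⟨w', List.Sublist.refl w', List.forall₂_iff_get.2 ⟨by simp; omega, fun s _ hs => ?_⟩⟩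
    have h1 : 1 ≤ w'[s] := hw' _ (List.getElem_mem hs)
    rcases lt_trichotomy s i with hsi | rfl | hsi
    · simpa [List.getElem_append, hsi]
    · simpa
    · obtain ⟨t, rfl⟩ : ∃ t, s = i + (t + 1) := ⟨s - i - 1, by omega⟩
      simpa [List.getElem_append]

theorem twos_compLE_blockWord_iff {a b : ℕ → ℕ} {r j : ℕ} (hb : ∀ s < r, 2 ≤ b s) :
    CompLE (List.replicate j 2) (blockWord a b r) ↔ j ≤ r := by
  have twos (i : ℕ) : List.replicate i 2 = (List.range i).map fun _ => 2 := by simp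
  constructor
  · intro h
    by_contra! hlt
    obtain ⟨t, rfl⟩ := Nat.exists_eq_add_of_lt hlt
    rw [add_assoc, List.replicate_add, twos, blockWord,
      tokens_compLE_blockPrefix_iff (fun _ _ => .inl rfl) hb, List.replicate_succ,
      ← List.append_nil (List.replicate (a r) 1)] at h
    exact CompLE.not_cons_nil (h.of_ones_append le_rfl)
  · intro h
    refine CompLE.trans ⟨_, (List.replicate_sublist_replicate 2).2 h, List.forall₂_refl _⟩ ?_
    rw [twos, ← List.append_nil ((List.range r).map _), blockWord,
      tokens_compLE_blockPrefix_iff (fun _ _ => .inl rfl) hb]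
    exact CompLE.nil_left _

theorem gap_pos_of_compLE {a b a' b' : ℕ → ℕ} {r m i : ℕ}
    (H : ∀ u, IsComposition u → u.sum ≤ m →
      CompLE u (blockWord a' b' r) → CompLE u (blockWord a b r))
    (hb : ∀ s < r, 2 ≤ b s) (hb' : ∀ s < r, 2 ≤ b' s) (hm : 2 * r + 1 ≤ m) (hi : i ≤ r)
    (h : 1 ≤ a' i) : 1 ≤ a i := by
  by_contra! h0
  have := le_of_gap_lt (τ := fun _ => 2) H (fun _ _ => .inl rfl) (fun _ _ => .inl rfl) hb hb' hi
    (by omega)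
  simp at this
  omega

theorem eq_of_compLE_iff {w w' : List ℕ} {m : ℕ} (hw : IsComposition w) (hw' : IsComposition w')
    (hsum : w.sum = w'.sum) (hm : 2 * w.sum + 1 ≤ 3 * m)
    (H : ∀ u, IsComposition u → u.sum ≤ m → (CompLE u w ↔ CompLE u w')) : w = w' := by
  have H₁ u hu hs := (H u hu hs).1
  have H₂ u hu hs := (H u hu hs).2
  by_cases hlen : w.length < m
  · have hle := length_le_of_compLE hw' H₂ hlen
    have hl : w.length = w'.length :=
      (length_le_of_compLE hw H₁ (hle.trans_lt hlen)).antisymm hle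
    obtain ⟨r, a, b, b', hb, hb', h, h'⟩ := exists_blockWord_of_zip (w.zip w') (by
      intro p hp
      obtain ⟨i, hi, rfl⟩ := List.mem_iff_getElem.1 hp
      have hi₁ : i < w.length := by simp at hi; omega
      have hi₂ : i < w'.length := by omega
      have h₁ := two_le_getElem_of_compLE hw' H₂ hlen hl hi₁ hi₂
      have h₂ := two_le_getElem_of_compLE hw H₁ (hl ▸ hlen) hl.symm hi₂ hi₁
      have := hw _ (List.getElem_mem hi₁)
      have := hw' _ (List.getElem_mem hi₂)
      rw [List.getElem_zip]
      simp only
      omega)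
    rw [List.map_fst_zip hl.le] at h
    rw [List.map_snd_zip hl.ge] at h'
    subst h h'
    exact blockWord_eq_of_compLE_iff H (fun _ _ => .inl rfl) hb hb' hsum hm
  · have hlen' : m ≤ w'.length := by
      simpa using (H₁ (List.replicate m 1) (isComposition_replicate le_rfl _) (by simp)
        (hw.ones_compLE (not_lt.1 hlen))).length_le
    obtain ⟨r, a, b, hb, rfl⟩ := hw.exists_blockWord
    obtain ⟨r', a', b', hb', rfl⟩ := hw'.exists_blockWord
    have hr := two_mul_add_sum_sub hb
    have hr' := two_mul_add_sum_sub hb'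
    have hs := sum_blockWord a b r
    have hs' := sum_blockWord a' b' r'
    rw [length_blockWord] at hlen hlen'
    have twos (j : ℕ) : IsComposition (List.replicate j 2) := isComposition_replicate (by omega) j
    obtain rfl : r = r' := by
      refine le_antisymm ?_ ?_
      · exact (twos_compLE_blockWord_iff hb').1
          (H₁ _ (twos r) (by simp; omega) ((twos_compLE_blockWord_iff hb).2 le_rfl))
      · exact (twos_compLE_blockWord_iff hb).1
          (H₂ _ (twos r') (by simp; omega) ((twos_compLE_blockWord_iff hb').2 le_rfl))
    refine blockWord_eq_of_compLE_iff H (fun s hs => ?_) hb hb' hsum hm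
    have := gap_pos_of_compLE (i := s) H₂ hb hb' (by omega) hs
    have := gap_pos_of_compLE (i := s) H₁ hb' hb (by omega) hs
    omega

theorem composition_reconstruction (k n : ℕ) (w w' : List ℕ)
    (hw : IsComposition w) (hw' : IsComposition w')
    (hnw : w.sum = n) (hnw' : w'.sum = n) (h : 3 * k + 1 ≤ n)
    (hdel : kDel k w = kDel k w') : w = w' := by
  refine eq_of_compLE_iff (m := n - k) hw hw' (hnw.trans hnw'.symm) (by omega) fun u hu hs =>
    ⟨compLE_of_kDel_subset hw hdel.subset hu (by omega),
      compLE_of_kDel_subset hw' hdel.superset hu (by omega)⟩
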